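/- arXiv:hep-th/9407083 — 2 statements merged into one kernel-verified Lean document; each statement's English description precedes it below -/
import Mathlib

section
/- There exists a finite-dimensional associative (not necessarily unital) ℂ-algebra A equipped with a ℤ_{n−2}-grading A = A₀ ⊕ A₁ ⊕ ⋯ ⊕ A_{n−3} (i.e. A_i · A_j ⊆ A_{(i+j) mod (n−2)}) and a nondegenerate symmetric bilinear form q on A satisfying the invariance q(a·b, c) = q(a, b·c) for all a, b, c ∈ A, such that: the degree-1 component of A is (a copy of) A₁ and q restricted to A₁ × A₁ equals q₁; q(A_i, A_j) = 0 whenever i + j ≢ 2 mod (n−2); and Γ(a₁, …, a_{n−1}) = a₁ · a₂ ⋯ a_{n−1} for all a₁, …, a_{n−1} ∈ A₁. -/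
noncomputable section

/-- A finite-dimensional, `ℤ_p`-graded, associative (not necessarily unital), metrised
complex algebra: a vector space `A = ⊕_{k=0}^{p-1} A_k` with a bilinear associative
multiplication satisfying `A_i · A_j ⊆ A_{(i+j) mod p}` and a nondegenerate symmetric
invariant bilinear form `q`. -/
structure MetrisedGradedAlgebra (p : ℕ) where
  carrier : Type
  [acg : AddCommGroup carrier]
  [mod : Module ℂ carrier]
  findim : FiniteDimensional ℂ carrier
  mul : carrier →ₗ[ℂ] carrier →ₗ[ℂ] carrier
  mul_assoc' : ∀ a b c : carrier, mul (mul a b) c = mul a (mul b c)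
  comp : ZMod p → Submodule ℂ carrier
  internal : DirectSum.IsInternal comp
  comp_mul : ∀ i j : ZMod p, ∀ a ∈ comp i, ∀ b ∈ comp j, mul a b ∈ comp (i + j)
  q : carrier →ₗ[ℂ] carrier →ₗ[ℂ] ℂ
  q_symm : ∀ a b : carrier, q a b = q b a
  q_nondeg : ∀ a : carrier, (∀ b : carrier, q a b = 0) → a = 0
  q_invariant : ∀ a b c : carrier, q (mul a b) c = q a (mul b c)

attribute [instance] MetrisedGradedAlgebra.acg MetrisedGradedAlgebra.mod

namespace GMA
section
variable {A : Type} [AddCommGroup A] [Module ℂ A] {p : ℕ}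
  (Γ : MultilinearMap ℂ (fun _ : Fin (p + 1) => A) A)

def gl (l : List A) : A := Γ (fun i => l.getD i.1 0)

def ev : ℕ → List A → A
  | 0, l => l.getD 0 0
  | m + 1, l => ev m (gl Γ l :: l.drop (p + 1))

lemma gl_congr {l l' : List A} (h : ∀ i < p + 1, l.getD i 0 = l'.getD i 0) :
    gl Γ l = gl Γ l' := by
  unfold gl
  congr 1
  funext i
  exact h i.1 i.2

lemma ev_append (m : ℕ) : ∀ l l' : List A, m * p + 1 ≤ l.length →
    ev Γ m (l ++ l') = ev Γ m l := by
  induction m with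
  | zero =>
    intro l l' h
    cases l with
    | nil => simp at h
    | cons x l => simp [ev]
  | succ m ih =>
    intro l l' h
    have hl : p + 1 ≤ l.length := by
      have : (m + 1) * p = m * p + p := by ring
      omega
    simp only [ev]
    rw [List.drop_append_of_le_length hl, ← List.cons_append, ih]
    · congr 2
      apply gl_congr
      intro i hi
      rw [List.getD_append _ _ _ _ (by omega)]
    · have : (m + 1) * p = m * p + p := by ring
      simp; omega

variable (hassoc : ∀ r s : ℕ, r ≤ p → s ≤ p → ∀ a : ℕ → A,
      Γ (fun i : Fin (p + 1) =>
          if i.1 < r then a i.1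
          else if i.1 = r then Γ (fun j : Fin (p + 1) => a (r + j.1))
          else a (i.1 + p)) =
      Γ (fun i : Fin (p + 1) =>
          if i.1 < s then a i.1
          else if i.1 = s then Γ (fun j : Fin (p + 1) => a (s + j.1))
          else a (i.1 + p)))

include hassoc

lemma gl_assoc (L : List A) (r : ℕ) (hr : r ≤ p) (hL : r ≤ L.length) :
    gl Γ (L.take r ++ gl Γ (L.drop r) :: L.drop (r + p + 1)) =
      gl Γ (gl Γ L :: L.drop (p + 1)) := by
  have h := hassoc r 0 hr (Nat.zero_le _) (fun i => L.getD i 0)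
  convert h using 1
  · unfold gl
    congr 1
    funext i
    have hlen : (L.take r).length = r := by simp [hL]
    split_ifs with h1 h2
    · rw [List.getD_append _ _ _ _ (by omega)]
      simp [List.getD_eq_getElem?_getD, h1]
    · rw [List.getD_append_right _ _ _ _ (by omega), hlen, h2]
      simp [List.getD_eq_getElem?_getD, List.getElem?_drop]
    · rw [List.getD_append_right _ _ _ _ (by omega), hlen]
      obtain ⟨k, hk⟩ : ∃ k, i.1 - r = k + 1 := ⟨i.1 - r - 1, by omega⟩
      rw [hk]
      simp only [List.getD_eq_getElem?_getD, List.getElem?_drop, List.getElem?_cons_succ]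
      congr 2
      omega
  · unfold gl
    congr 1
    funext i
    rcases Nat.eq_zero_or_pos i.1 with h0 | h0
    · simp [h0]
    · obtain ⟨k, hk⟩ : ∃ k, i.1 = k + 1 := ⟨i.1 - 1, by omega⟩
      rw [hk]
      simp only [List.getD_eq_getElem?_getD, List.getElem?_drop, List.getElem?_cons_succ]
      simp
      congr 2
      omega

lemma ev_red (m : ℕ) : ∀ (L : List A) (r : ℕ), r ≤ m * p → r ≤ L.length →
    ev Γ m (L.take r ++ gl Γ (L.drop r) :: L.drop (r + p + 1)) = ev Γ (m + 1) L := by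
  induction m with
  | zero =>
    intro L r hr _
    have : r = 0 := by simpa using hr
    subst this
    simp [ev]
  | succ m ih =>
    intro L r hr hL
    have hlen : (L.take r).length = r := by simp [hL]
    rcases Nat.eq_zero_or_pos r with h0 | h0
    · subst h0
      simp [ev]
    rcases Nat.lt_or_ge p r with h1 | h1
    · have hmp : (m + 1) * p = m * p + p := by ring
      have key := ih (gl Γ L :: L.drop (p + 1)) (r - p) (by omega) (by simp; omega)
      rw [ev]
      conv_rhs => rw [ev]
      rw [← key]
      obtain ⟨k, hk⟩ : ∃ k, r = p + 1 + k := ⟨r - (p + 1), by omega⟩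
      subst hk
      have e1 : p + 1 + k - p = k + 1 := by omega
      rw [e1]
      congr 1
      have e2 : k + 1 + p + 1 = (k + p + 1) + 1 := by ring
      rw [e2, List.take_succ_cons, List.drop_succ_cons, List.drop_succ_cons, List.cons_append,
        List.drop_append_of_le_length (by omega), List.drop_drop, List.drop_drop, List.drop_take]
      congr 1
      · apply gl_congr
        intro i hi
        rw [List.getD_append _ _ _ _ (by omega)]
        simp only [List.getD_eq_getElem?_getD, List.getElem?_take]
        rw [if_pos (by omega)]
      · have e3 : p + 1 + k - (p + 1) = k := by omega
        have e4 : p + 1 + k + p + 1 = p + 1 + (k + p + 1) := by ring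
        rw [e3, e4]
    · rw [ev, ev, ev, gl_assoc Γ hassoc L r h1 hL]
      congr 2
      rw [List.drop_append, hlen, List.drop_eq_nil_of_le (by omega), List.nil_append]
      have e1 : p + 1 - r = (p - r) + 1 := by omega
      rw [e1, List.drop_succ_cons, List.drop_succ_cons, List.drop_drop, List.drop_drop]
      congr 1
      omega

variable (q₁ : A →ₗ[ℂ] A →ₗ[ℂ] ℂ)
    (hinv : ∀ a : ℕ → A,
      q₁ (Γ (fun i : Fin (p + 1) => a i.1)) (a (p + 1)) =
        q₁ (a 0) (Γ (fun i : Fin (p + 1) => a (i.1 + 1))))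
include hinv

lemma ev_inv (hp : 0 < p) (m : ℕ) : ∀ l : List A, m * p + 2 ≤ l.length →
    q₁ (l.getD 0 0) (ev Γ m (l.drop 1)) = q₁ (ev Γ m l) (l.getD (m * p + 1) 0) := by
  induction m with
  | zero =>
    intro l _
    simp [ev, List.getD_eq_getElem?_getD]
  | succ m ih =>
    intro l hl
    rcases Nat.eq_zero_or_pos m with h0 | h0
    · subst h0
      have := hinv (fun i => l.getD i 0)
      simp only [ev, gl, List.getD_cons_zero]
      simp only [zero_add, one_mul]
      rw [this]
      congr 2
      funext i
      simp [List.getD_eq_getElem?_getD]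
    · have hmp : (m + 1) * p = m * p + p := by ring
      have hmp' : p ≤ m * p := Nat.le_mul_of_pos_left p h0
      have hr := ev_red Γ hassoc m l 1 (by omega) (by omega)
      have := ih (l.take 1 ++ gl Γ (l.drop 1) :: l.drop (1 + p + 1)) (by simp; omega)
      rw [hr] at this
      cases l with
      | nil => simp at hl
      | cons x l =>
        simp only [List.take_succ_cons, List.take_zero, List.cons_append, List.nil_append,
          List.getD_cons_zero, List.drop_succ_cons, List.drop_zero] at this
        simp only [List.getD_cons_zero, List.drop_succ_cons, List.drop_zero]
        rw [ev]
        have e : 1 + p = p + 1 := by ring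
        rw [e] at this
        rw [this]
        congr 1
        obtain ⟨k, hk⟩ : ∃ k, m * p = k + 1 := ⟨m * p - 1, by omega⟩
        rw [hmp, hk]
        simp only [List.getD_cons_succ]
        have e2 : k + 1 + p = (p + 1) + k := by ring
        rw [e2]
        simp [List.getD_eq_getElem?_getD]

omit hassoc hinv in
open Classical in
def tr : List A → ℂ
  | [] => 0
  | x :: l => if ∃ m, l.length = m * p + 1 then q₁ x (ev Γ ((l.length - 1) / p) l) else 0

omit hassoc hinv in
lemma tr_eq (hp : 0 < p) (m : ℕ) (x : A) (l : List A) (h : l.length = m * p + 1) :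
    tr Γ q₁ (x :: l) = q₁ x (ev Γ m l) := by
  rw [tr, if_pos ⟨m, h⟩, h]
  simp [Nat.mul_div_cancel _ hp]

omit hassoc hinv in
lemma tr_zero (x : A) (l : List A) (h : ¬ ∃ m, l.length = m * p + 1) :
    tr Γ q₁ (x :: l) = 0 := by
  rw [tr, if_neg h]

variable (hsymm : ∀ x y : A, q₁ x y = q₁ y x)
include hsymm

lemma tr_rot (hp : 0 < p) (l : List A) (y : A) : tr Γ q₁ (l ++ [y]) = tr Γ q₁ (y :: l) := by
  cases l with
  | nil => rfl
  | cons x l =>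
    by_cases h : ∃ m, l.length + 1 = m * p + 1
    · obtain ⟨m, h⟩ := h
      rw [List.cons_append, tr_eq Γ q₁ hp m x _ (by simpa using h),
        tr_eq Γ q₁ hp m y _ (by simpa using h)]
      have := ev_inv Γ hassoc q₁ hinv hp m (x :: (l ++ [y])) (by simp; omega)
      simp only [List.getD_cons_zero, List.drop_succ_cons, List.drop_zero] at this
      rw [this, hsymm, ← List.cons_append, ev_append _ _ _ _ (by simp; omega)]
      congr 1
      have : m * p = l.length := by omega
      rw [this]
      simp [List.getD_eq_getElem?_getD]
    · rw [List.cons_append, tr_zero _ _ _ _ (by simpa using h), tr_zero _ _ _ _ (by simpa using h)]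

lemma tr_comm (hp : 0 < p) (v : List A) : ∀ u, tr Γ q₁ (u ++ v) = tr Γ q₁ (v ++ u) := by
  induction v with
  | nil => simp
  | cons y v ih =>
    intro u
    have := ih (u ++ [y])
    rw [← List.append_assoc, tr_rot Γ hassoc q₁ hinv hsymm hp] at this
    simpa using this

lemma tr_red (hp : 0 < p) (u w : List A) (hu : u.length = p + 1) (hw : w ≠ []) :
    tr Γ q₁ (u ++ w) = tr Γ q₁ (gl Γ u :: w) := by
  rw [tr_comm Γ hassoc q₁ hinv hsymm hp, ← tr_rot Γ hassoc q₁ hinv hsymm hp]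
  cases w with
  | nil => exact absurd rfl hw
  | cons x w =>
    by_cases h : ∃ m, w.length = m * p
    · obtain ⟨m, h⟩ := h
      have hmp : (m + 1) * p = m * p + p := by ring
      rw [List.cons_append, List.cons_append, tr_eq Γ q₁ hp (m + 1) x _ (by simp; omega),
        tr_eq Γ q₁ hp m x _ (by simp; omega),
        ← ev_red Γ hassoc m (w ++ u) w.length (by omega) (by simp)]
      have e : (w ++ u).drop (w.length + p + 1) = [] :=
        List.drop_eq_nil_of_le (by simp; omega)
      rw [e]
      simp
    · rw [List.cons_append, List.cons_append, tr_zero, tr_zero]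
      · simpa using h
      · rintro ⟨m, hm⟩
        simp [hu] at hm
        cases m with
        | zero => simp at hm; omega
        | succ m =>
          refine h ⟨m, ?_⟩
          have hmp : (m + 1) * p = m * p + p := by ring
          omega

omit hassoc hinv hsymm in
lemma tr_deg (l : List A) (h : (l.length : ZMod p) ≠ 2) : tr Γ q₁ l = 0 := by
  cases l with
  | nil => rfl
  | cons x l =>
    apply tr_zero
    rintro ⟨m, hm⟩
    apply h
    simp [hm]
    norm_num

end

lemma exists_quot {S : Type} [Semigroup S] (t : S → ℂ) (ht : ∀ x y, t (x * y) = t (y * x)) :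
    ∃ (Q : Type) (_ : AddCommGroup Q) (_ : Module ℂ Q) (mul : Q →ₗ[ℂ] Q →ₗ[ℂ] Q)
      (q : Q →ₗ[ℂ] Q →ₗ[ℂ] ℂ) (w : S → Q),
      Submodule.span ℂ (Set.range w) = ⊤ ∧
      (∀ x y, mul (w x) (w y) = w (x * y)) ∧
      (∀ x y, q (w x) (w y) = t (x * y)) ∧
      (∀ a, (∀ b, q a b = 0) → a = 0) := by
  let T := MonoidAlgebra ℂ S
  let tl : T →ₗ[ℂ] ℂ := (Finsupp.linearCombination ℂ t).comp
    (MonoidAlgebra.coeffLinearEquiv ℂ).toLinearMap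
  have htl : ∀ s c, tl (MonoidAlgebra.single s c) = c * t s := by
    intro s c
    exact Finsupp.linearCombination_single ..
  let M : T →ₗ[ℂ] T →ₗ[ℂ] T := LinearMap.mul ℂ T
  let B : T →ₗ[ℂ] T →ₗ[ℂ] ℂ := M.compr₂ tl
  have hB : ∀ x y, B x y = tl (x * y) := fun x y => rfl
  have hcomm : ∀ x y : T, tl (x * y) = tl (y * x) := by
    intro x y
    induction x using MonoidAlgebra.induction_linear with
    | zero => simp
    | add a b ha hb => rw [add_mul, mul_add, map_add, map_add, ha, hb]
    | single s c =>
      induction y using MonoidAlgebra.induction_linear with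
      | zero => simp
      | add a b ha hb => rw [add_mul, mul_add, map_add, map_add, ha, hb]
      | single s' c' =>
        rw [MonoidAlgebra.single_mul_single, MonoidAlgebra.single_mul_single, htl, htl, ht,
          mul_comm c]
  let R : Submodule ℂ T := LinearMap.ker B
  have hR : ∀ x, x ∈ R ↔ ∀ y, tl (x * y) = 0 := by
    intro x
    rw [LinearMap.mem_ker, LinearMap.ext_iff]
    rfl
  have hR1 : ∀ x ∈ R, ∀ y, x * y ∈ R := by
    intro x hx y
    rw [hR] at hx ⊢
    intro z
    rw [mul_assoc]
    exact hx _
  have hR2 : ∀ x ∈ R, ∀ y, y * x ∈ R := by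
    intro x hx y
    rw [hR] at hx ⊢
    intro z
    rw [mul_assoc, hcomm, mul_assoc]
    exact hx _
  let mq : T →ₗ[ℂ] T →ₗ[ℂ] (T ⧸ R) := M.compr₂ R.mkQ
  let mul : (T ⧸ R) →ₗ[ℂ] (T ⧸ R) →ₗ[ℂ] (T ⧸ R) := mq.liftQ₂ R R
    (by
      intro x hx
      rw [LinearMap.mem_ker, LinearMap.ext_iff]
      intro y
      exact (Submodule.Quotient.mk_eq_zero R).2 (hR1 x hx y))
    (by
      intro x hx
      rw [LinearMap.mem_ker, LinearMap.ext_iff]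
      intro y
      exact (Submodule.Quotient.mk_eq_zero R).2 (hR2 x hx y))
  let q : (T ⧸ R) →ₗ[ℂ] (T ⧸ R) →ₗ[ℂ] ℂ := B.liftQ₂ R R le_rfl
    (by
      intro x hx
      rw [LinearMap.mem_ker, LinearMap.ext_iff]
      intro y
      rw [LinearMap.flip_apply, hB, hcomm]
      exact (hR x).1 hx y)
  refine ⟨T ⧸ R, inferInstance, inferInstance, mul, q,
    fun s => R.mkQ (MonoidAlgebra.single s 1), ?_, ?_, ?_, ?_⟩
  · rw [eq_top_iff]
    rintro x -
    obtain ⟨x, rfl⟩ := R.mkQ_surjective x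
    induction x using MonoidAlgebra.induction_linear with
    | zero => simp
    | add a b ha hb => rw [map_add]; exact Submodule.add_mem _ ha hb
    | single s c =>
      have : (MonoidAlgebra.single s c : T) = c • MonoidAlgebra.single s 1 := by
        simp [MonoidAlgebra.smul_single]
      rw [this, map_smul]
      exact Submodule.smul_mem _ _ (Submodule.subset_span ⟨s, rfl⟩)
  · intro x y
    change R.mkQ (MonoidAlgebra.single x 1 * MonoidAlgebra.single y 1) = _
    rw [MonoidAlgebra.single_mul_single, one_mul]
  · intro x y
    change tl (MonoidAlgebra.single x 1 * MonoidAlgebra.single y 1) = _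
    rw [MonoidAlgebra.single_mul_single, htl, one_mul, one_mul]
  · intro a h
    obtain ⟨x, rfl⟩ := R.mkQ_surjective a
    refine (Submodule.Quotient.mk_eq_zero R).2 ((hR x).2 fun y => ?_)
    exact h (R.mkQ y)

lemma tr_head {A : Type} [AddCommGroup A] [Module ℂ A] {p : ℕ}
    (Γ : MultilinearMap ℂ (fun _ : Fin (p + 1) => A) A) (q₁ : A →ₗ[ℂ] A →ₗ[ℂ] ℂ) (l : List A) :
    ∃ F : A →ₗ[ℂ] ℂ, ∀ x, tr Γ q₁ (x :: l) = F x := by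
  by_cases h : ∃ m, l.length = m * p + 1
  · exact ⟨q₁.flip (ev Γ ((l.length - 1) / p) l), fun x => by rw [tr, if_pos h]; rfl⟩
  · exact ⟨0, fun x => by rw [tr, if_neg h]; rfl⟩

def wl {A : Type} (s : FreeSemigroup A) : List A := s.head :: s.tail

lemma wl_mul {A : Type} (s s' : FreeSemigroup A) : wl (s * s') = wl s ++ wl s' := rfl

lemma main (p : ℕ) (hp : 0 < p)
    (A : Type) [AddCommGroup A] [Module ℂ A] [FiniteDimensional ℂ A]
    (Γ : MultilinearMap ℂ (fun _ : Fin (p + 1) => A) A)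
    (q₁ : A →ₗ[ℂ] A →ₗ[ℂ] ℂ)
    (hsymm : ∀ x y : A, q₁ x y = q₁ y x)
    (hnondeg : ∀ x : A, (∀ y : A, q₁ x y = 0) → x = 0)
    (hinv : ∀ a : ℕ → A,
      q₁ (Γ (fun i : Fin (p + 1) => a i.1)) (a (p + 1)) =
        q₁ (a 0) (Γ (fun i : Fin (p + 1) => a (i.1 + 1))))
    (hassoc : ∀ r s : ℕ, r ≤ p → s ≤ p → ∀ a : ℕ → A,
      Γ (fun i : Fin (p + 1) =>
          if i.1 < r then a i.1
          else if i.1 = r then Γ (fun j : Fin (p + 1) => a (r + j.1))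
          else a (i.1 + p)) =
      Γ (fun i : Fin (p + 1) =>
          if i.1 < s then a i.1
          else if i.1 = s then Γ (fun j : Fin (p + 1) => a (s + j.1))
          else a (i.1 + p))) :
    ∃ (G : MetrisedGradedAlgebra p) (f : A →ₗ[ℂ] G.carrier),
      Function.Injective f ∧
      LinearMap.range f = G.comp 1 ∧
      (∀ x y : A, G.q (f x) (f y) = q₁ x y) ∧
      (∀ i j : ZMod p, i + j ≠ 2 → ∀ a ∈ G.comp i, ∀ b ∈ G.comp j, G.q a b = 0) ∧
      (∀ a : ℕ → A,
        (List.ofFn (fun i : Fin p => f (a (i.1 + 1)))).foldl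
            (fun u v => G.mul u v) (f (a 0)) =
          f (Γ (fun i : Fin (p + 1) => a i.1))) := by
  obtain ⟨Q, _, _, mul, q, w, hspan, hmul, hq, hnd⟩ :=
    exists_quot (S := FreeSemigroup A) (fun s => tr Γ q₁ (wl s))
      (fun x y => tr_comm Γ hassoc q₁ hinv hsymm hp (wl y) (wl x))
  have ext0 : ∀ {P : Type} [AddCommGroup P] [Module ℂ P] {F F' : Q →ₗ[ℂ] P},
      (∀ s, F (w s) = F' (w s)) → F = F' := by
    intro P _ _ F F' h
    refine LinearMap.ext_on hspan ?_
    rintro _ ⟨s, rfl⟩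
    exact h s
  have hind : ∀ {P : Q → Prop} (base : ∀ s, P (w s)) (zero : P 0)
      (add : ∀ x y, P x → P y → P (x + y)) (smul : ∀ (r : ℂ) x, P x → P (r • x)) (a : Q), P a := by
    intro P base zero add smul a
    have ha : a ∈ Submodule.span ℂ (Set.range w) := hspan ▸ Submodule.mem_top
    induction ha using Submodule.span_induction with
    | mem x h => obtain ⟨s, rfl⟩ := h; exact base s
    | zero => exact zero
    | add x y _ _ hx hy => exact add x y hx hy
    | smul r x _ hx => exact smul r x hx
  have ndw : ∀ a b, (∀ s, q a (w s) = q b (w s)) → a = b := by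
    intro a b h
    rw [← sub_eq_zero]
    apply hnd
    intro c
    have : q a = q b := ext0 h
    rw [map_sub, this, sub_self, LinearMap.zero_apply]
  have hassQ : ∀ a b c, mul (mul a b) c = mul a (mul b c) := by
    intro a b c
    induction a using hind with
    | zero => simp
    | add x y hx hy => simp only [map_add, LinearMap.add_apply, hx, hy]
    | smul r x hx => simp only [map_smul, LinearMap.smul_apply, hx]
    | base s =>
      induction b using hind with
      | zero => simp
      | add x y hx hy => simp only [map_add, LinearMap.add_apply, hx, hy]
      | smul r x hx => simp only [map_smul, LinearMap.smul_apply, hx]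
      | base s' =>
        induction c using hind with
        | zero => simp
        | add x y hx hy => simp only [map_add, hx, hy]
        | smul r x hx => simp only [map_smul, hx]
        | base s'' => rw [hmul, hmul, hmul, hmul, mul_assoc]
  have hqs : ∀ a b, q a b = q b a := by
    have : q = q.flip := by
      refine ext0 fun s => ext0 fun s' => ?_
      rw [LinearMap.flip_apply, hq, hq]
      exact tr_comm Γ hassoc q₁ hinv hsymm hp (wl s') (wl s)
    intro a b
    conv_lhs => rw [this]
    rfl
  have hqi : ∀ a b c, q (mul a b) c = q a (mul b c) := by
    intro a b c
    induction a using hind with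
    | zero => simp
    | add x y hx hy => simp only [map_add, LinearMap.add_apply, hx, hy]
    | smul r x hx => simp only [map_smul, LinearMap.smul_apply, hx]
    | base s =>
      induction b using hind with
      | zero => simp
      | add x y hx hy => simp only [map_add, LinearMap.add_apply, hx, hy]
      | smul r x hx => simp only [map_smul, LinearMap.smul_apply, hx]
      | base s' =>
        induction c using hind with
        | zero => simp
        | add x y hx hy => simp only [map_add, hx, hy]
        | smul r x hx => simp only [map_smul, hx]
        | base s'' => rw [hmul, hmul, hq, hq, mul_assoc]
  have hred : ∀ (s s' : FreeSemigroup A) (u v : List A), u.length = p + 1 → wl s = u ++ v →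
      s' = ⟨gl Γ u, v⟩ → w s = w s' := by
    rintro s s' u v hu hs rfl
    refine ndw _ _ fun x => ?_
    rw [hq, hq, wl_mul, wl_mul, hs, List.append_assoc,
      tr_red Γ hassoc q₁ hinv hsymm hp u _ hu (by simp [wl])]
    rfl
  let f : A →ₗ[ℂ] Q :=
    { toFun := fun a => w ⟨a, []⟩
      map_add' := by
        intro a b
        refine ndw _ _ fun s => ?_
        rw [map_add, LinearMap.add_apply, hq, hq, hq]
        obtain ⟨F, hF⟩ := tr_head Γ q₁ (wl s)
        exact (hF _).trans ((map_add F a b).trans (congrArg₂ _ (hF a).symm (hF b).symm))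
      map_smul' := by
        intro c a
        refine ndw _ _ fun s => ?_
        rw [map_smul, LinearMap.smul_apply, hq, hq]
        obtain ⟨F, hF⟩ := tr_head Γ q₁ (wl s)
        exact (hF _).trans ((map_smul F c a).trans (congrArg _ (hF a).symm)) }
  have hf : ∀ a, f a = w ⟨a, []⟩ := fun a => rfl
  have hfq : ∀ x y : A, q (f x) (f y) = q₁ x y := by
    intro x y
    rw [hf, hf, hq, wl_mul]
    exact tr_eq Γ q₁ hp 0 x [y] (by simp)
  have hcons : ∀ a b l, mul (f a) (w ⟨b, l⟩) = w ⟨a, b :: l⟩ := fun a b l => hmul _ _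
  have hsnoc : ∀ a b l, mul (w ⟨b, l⟩) (f a) = w ⟨b, l ++ [a]⟩ := fun a b l => hmul _ _
  let comp : ZMod p → Submodule ℂ Q := fun i =>
    Submodule.span ℂ (w '' {s | ((wl s).length : ZMod p) = i})
  have hcw : ∀ s, w s ∈ comp ((wl s).length : ZMod p) := fun s =>
    Submodule.subset_span ⟨s, rfl, rfl⟩
  have hcm : ∀ i j : ZMod p, ∀ a ∈ comp i, ∀ b ∈ comp j, mul a b ∈ comp (i + j) := by
    intro i j a ha b hb
    have h := Submodule.apply_mem_map₂ mul ha hb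
    rw [Submodule.map₂_span_span] at h
    refine Submodule.span_mono ?_ h
    rintro _ ⟨_, ⟨s, hs, rfl⟩, _, ⟨s', hs', rfl⟩, rfl⟩
    refine ⟨s * s', ?_, (hmul s s').symm⟩
    simp only [Set.mem_ofPred_eq] at hs hs' ⊢
    rw [wl_mul, List.length_append, Nat.cast_add, hs, hs']
  have hcq : ∀ i j : ZMod p, i + j ≠ 2 → ∀ a ∈ comp i, ∀ b ∈ comp j, q a b = 0 := by
    intro i j hij a ha b hb
    have h := Submodule.apply_mem_map₂ q ha hb
    rw [Submodule.map₂_span_span] at h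
    rw [← Submodule.mem_bot ℂ]
    refine Submodule.span_le.2 ?_ h
    rintro _ ⟨_, ⟨s, hs, rfl⟩, _, ⟨s', hs', rfl⟩, rfl⟩
    simp only [Set.mem_ofPred_eq] at hs hs'
    change q (w s) (w s') = 0
    rw [hq]
    apply tr_deg
    rw [wl_mul, List.length_append, Nat.cast_add, hs, hs']
    exact hij
  have htop : ⨆ i, comp i = ⊤ := by
    rw [eq_top_iff, ← hspan, Submodule.span_le]
    rintro _ ⟨s, rfl⟩
    exact Submodule.mem_iSup_of_mem _ (hcw s)
  have hinternal : DirectSum.IsInternal comp := by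
    refine DirectSum.isInternal_submodule_of_iSupIndep_of_iSup_eq_top ?_ htop
    intro i
    rw [Submodule.disjoint_def]
    intro x hx hx'
    apply ndw
    intro s
    rw [map_zero, LinearMap.zero_apply]
    by_cases h : i + ((wl s).length : ZMod p) = 2
    · have : (⨆ j, ⨆ (_ : j ≠ i), comp j) ≤ LinearMap.ker (q.flip (w s)) := by
        refine iSup_le fun j => iSup_le fun hj => fun y hy => ?_
        refine hcq j _ ?_ y hy _ (hcw s)
        intro h'
        exact hj (add_right_cancel (h'.trans h.symm))
      exact this hx'
    · exact hcq i _ h x hx _ (hcw s)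
  have hrange : LinearMap.range f = comp 1 := by
    apply le_antisymm
    · rintro _ ⟨a, rfl⟩
      have := hcw ⟨a, []⟩
      rw [hf]
      simpa [wl] using this
    · refine Submodule.span_le.2 ?_
      rintro _ ⟨s, hs, rfl⟩
      simp only [Set.mem_ofPred_eq] at hs
      induction hN : (wl s).length using Nat.strong_induction_on generalizing s with
      | _ N ih =>
        obtain ⟨a, l⟩ := s
        rcases Nat.lt_or_ge N (p + 1) with h | h
        · have hl : l = [] := by
            rw [hN, ← Nat.cast_one, ZMod.natCast_eq_natCast_iff] at hs
            have hN' : N = l.length + 1 := by rw [← hN]; rfl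
            have hd : p ∣ N - 1 := (Nat.modEq_iff_dvd' (by omega)).1 hs.symm
            have := Nat.eq_zero_of_dvd_of_lt hd (by omega)
            exact List.length_eq_zero_iff.1 (by omega)
          subst hl
          exact ⟨a, rfl⟩
        · rw [hred ⟨a, l⟩ _ ((wl ⟨a, l⟩).take (p + 1)) ((wl ⟨a, l⟩).drop (p + 1))
            (by simp [hN, h]) (List.take_append_drop _ _).symm rfl]
          have e : (wl (⟨gl Γ ((wl ⟨a, l⟩).take (p + 1)), (wl ⟨a, l⟩).drop (p + 1)⟩ :
              FreeSemigroup A)).length = N - p := by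
            rw [← hN] at h ⊢
            simp only [wl, List.length_cons, List.length_drop] at h ⊢
            omega
          refine ih (N - p) (by omega) _ ?_ e
          rw [e, Nat.cast_sub (by omega), ZMod.natCast_self, sub_zero, ← hN, hs]
  let W : ℕ → Submodule ℂ Q := fun k =>
    Nat.rec (LinearMap.range f) (fun _ V => Submodule.map₂ mul (LinearMap.range f) V) k
  have hWfg : ∀ k, (W k).FG := by
    have hrf : (LinearMap.range f).FG := Module.Finite.iff_fg.1 inferInstance
    intro k
    induction k with
    | zero => exact hrf
    | succ k ih => exact Submodule.FG.map₂ mul hrf ih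
  have hWw : ∀ l a, w ⟨a, l⟩ ∈ W l.length := by
    intro l
    induction l with
    | nil => exact fun a => ⟨a, rfl⟩
    | cons b l ih =>
      intro a
      rw [← hcons]
      exact Submodule.apply_mem_map₂ mul ⟨a, rfl⟩ (ih b)
  have hWtop : ⨆ k : Fin p, W k = ⊤ := by
    rw [eq_top_iff, ← hspan, Submodule.span_le]
    rintro _ ⟨s, rfl⟩
    induction hN : (wl s).length using Nat.strong_induction_on generalizing s with
    | _ N ih =>
      obtain ⟨a, l⟩ := s
      have hN' : N = l.length + 1 := by rw [← hN]; rfl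
      rcases Nat.lt_or_ge N (p + 1) with h | h
      · exact Submodule.mem_iSup_of_mem (⟨l.length, by omega⟩ : Fin p) (hWw l a)
      · rw [hred ⟨a, l⟩ _ ((wl ⟨a, l⟩).take (p + 1)) ((wl ⟨a, l⟩).drop (p + 1))
          (by simp [hN, h]) (List.take_append_drop _ _).symm rfl]
        have e : (wl (⟨gl Γ ((wl ⟨a, l⟩).take (p + 1)), (wl ⟨a, l⟩).drop (p + 1)⟩ :
            FreeSemigroup A)).length = N - p := by
          rw [← hN] at h ⊢
          simp only [wl, List.length_cons, List.length_drop] at h ⊢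
          omega
        exact ih (N - p) (by omega) _ e
  have hfd : FiniteDimensional ℂ Q := by
    refine ⟨?_⟩
    rw [← hWtop]
    exact Submodule.fg_iSup _ fun k => hWfg _
  refine ⟨⟨Q, hfd, mul, hassQ, comp, hinternal, hcm, q, hqs, hnd, hqi⟩, f, ?_, hrange, hfq, hcq, ?_⟩
  · rw [injective_iff_map_eq_zero]
    intro x hx
    apply hnondeg
    intro y
    rw [← hfq, hx, map_zero, LinearMap.zero_apply]
  · intro a
    have hfold : ∀ (l l' : List A) (b : A),
        (l.map f).foldl (fun u v => mul u v) (w ⟨b, l'⟩) = w ⟨b, l' ++ l⟩ := by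
      intro l
      induction l with
      | nil => simp
      | cons x l ih =>
        intro l' b
        rw [List.map_cons, List.foldl_cons, hsnoc, ih]
        simp
    have := hfold (List.ofFn (fun i : Fin p => a (i.1 + 1))) [] (a 0)
    rw [List.map_ofFn] at this
    refine this.trans ?_
    refine (hred _ _ (List.ofFn (fun i : Fin (p + 1) => a i.1)) [] (by simp) ?_ rfl).trans ?_
    · simp [wl, List.ofFn_succ]
    · rw [← hf]
      congr 1
      unfold gl
      congr 1
      funext i
      rw [List.getD_eq_getElem?_getD, List.getElem?_ofFn, dif_pos i.2]
      rfl

end GMA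

/-- **main theorem.**  Let `n ≥ 3`, `p = n − 2`, let `A₁` be a
finite-dimensional complex vector space, `Γ : A₁^{×(n−1)} → A₁` a multilinear map and
`q₁` a nondegenerate symmetric bilinear form on `A₁` satisfying the invariance condition
and the general associativity condition.  Then there exists a `ℤ_{n−2}`-graded,
associative, metrised algebra `(A = A₀ ⊕ ⋯ ⊕ A_{n−3}, q)` such that the degree-1
component of `A` is a copy of `A₁`, `q` restricted to `A₁ × A₁` is `q₁`,
`q(A_i, A_j) = 0` whenever `i + j ≢ 2 mod (n−2)`, and
`Γ(a₁, …, a_{n−1}) = a₁ ⋯ a_{n−1}` for all `a₁, …, a_{n−1} ∈ A₁`. -/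
theorem exists_graded_metrised_algebra
    (n p : ℕ) (hn : 3 ≤ n) (hp : p = n - 2)
    (A : Type) [AddCommGroup A] [Module ℂ A] [FiniteDimensional ℂ A]
    (Γ : MultilinearMap ℂ (fun _ : Fin (n - 1) => A) A)
    (q₁ : A →ₗ[ℂ] A →ₗ[ℂ] ℂ)
    (hq₁symm : ∀ x y : A, q₁ x y = q₁ y x)
    (hq₁nondeg : ∀ x : A, (∀ y : A, q₁ x y = 0) → x = 0)
    (hinv : ∀ a : ℕ → A,
      q₁ (Γ (fun i : Fin (n - 1) => a i.1)) (a (n - 1)) =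
        q₁ (a 0) (Γ (fun i : Fin (n - 1) => a (i.1 + 1))))
    (hassoc : ∀ r s : ℕ, r ≤ n - 2 → s ≤ n - 2 → ∀ a : ℕ → A,
      Γ (fun i : Fin (n - 1) =>
          if i.1 < r then a i.1
          else if i.1 = r then Γ (fun j : Fin (n - 1) => a (r + j.1))
          else a (i.1 + (n - 2))) =
      Γ (fun i : Fin (n - 1) =>
          if i.1 < s then a i.1
          else if i.1 = s then Γ (fun j : Fin (n - 1) => a (s + j.1))
          else a (i.1 + (n - 2)))) :
    ∃ (G : MetrisedGradedAlgebra p) (f : A →ₗ[ℂ] G.carrier),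
      Function.Injective f ∧
      LinearMap.range f = G.comp 1 ∧
      (∀ x y : A, G.q (f x) (f y) = q₁ x y) ∧
      (∀ i j : ZMod p, i + j ≠ 2 → ∀ a ∈ G.comp i, ∀ b ∈ G.comp j, G.q a b = 0) ∧
      (∀ a : ℕ → A,
        (List.ofFn (fun i : Fin (n - 2) => f (a (i.1 + 1)))).foldl
            (fun u v => G.mul u v) (f (a 0)) =
          f (Γ (fun i : Fin (n - 1) => a i.1))) := by
  subst hp
  obtain ⟨k, rfl⟩ : ∃ k, n = k + 2 := ⟨n - 2, by omega⟩
  exact GMA.main k (by omega) A Γ q₁ hq₁symm hq₁nondeg hinv hassoc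
end
end

section
/- For homogeneous elements a ∈ A₁^{⊗n_a}, b ∈ A₁^{⊗n_b}, c ∈ A₁^{⊗n_c} of M with n_a + n_b + n_c ≡ 1 mod p, one has (a·b)·c = a·(b·c); and for homogeneous a, b, c, d ∈ M with n_a + n_b + n_c + n_d ≡ 1 mod p, one has ((a·b)·c)·d = (a·(b·c))·d. -/
open scoped TensorProduct DirectSum

noncomputable section

/-- The pure tensor `a₀ ⊗ a₁ ⊗ ⋯ ⊗ a_{m-1}` in the `m`-th tensor power. -/
def tp (A : Type) [AddCommGroup A] [Module ℂ A] (m : ℕ) (a : ℕ → A) : ⨂[ℂ]^m A :=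
  PiTensorProduct.tprod ℂ (fun i : Fin m => a i.1)

/-- The space `M = ⊕_{k=1}^{p} A₁^{⊗k}`; the component of index `k : Fin p` is the
tensor power of degree `k + 1`. -/
abbrev Mspace (p : ℕ) (A : Type) [AddCommGroup A] [Module ℂ A] : Type :=
  ⨁ k : Fin p, ⨂[ℂ]^(k.1 + 1) A

/-- Inclusion of the degree-`(k+1)` homogeneous component into `M`. -/
def incl (p : ℕ) (A : Type) [AddCommGroup A] [Module ℂ A] (k : Fin p) :
    (⨂[ℂ]^(k.1 + 1) A) →ₗ[ℂ] Mspace p A :=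
  DirectSum.lof ℂ (Fin p) (fun k : Fin p => ⨂[ℂ]^(k.1 + 1) A) k

/-- The one-step substitution `id^{⊗r} ⊗ Γ ⊗ id^{⊗(n-2-r)}` followed by `Γ`, evaluated on
a family of `2n−3` arguments; used to state the general associativity condition. -/
def gammaIns (n : ℕ) (A : Type) [AddCommGroup A] [Module ℂ A]
    (Γ : MultilinearMap ℂ (fun _ : Fin (n - 1) => A) A) (r : ℕ) (a : ℕ → A) : A :=
  Γ (fun i : Fin (n - 1) =>
    if i.1 < r then a i.1
    else if i.1 = r then Γ (fun j : Fin (n - 1) => a (r + j.1))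
    else a (i.1 + (n - 2)))

/-- `mul` is the bilinear multiplication of `M = ⊕_{k=1}^{p} A₁^{⊗k}` determined on
homogeneous pure tensors `a = a₁⊗⋯⊗a_k`, `b = b₁⊗⋯⊗b_l` by: `a·b = a ⊗ b` if
`k + l ≤ p`, and `a·b = Γ(a₁,…,a_k,b₁,…,b_{p+1−k}) ⊗ b_{p+2−k} ⊗ ⋯ ⊗ b_l` if
`k + l > p`. -/
def MulSpec (n p : ℕ) (A : Type) [AddCommGroup A] [Module ℂ A]
    (Γ : MultilinearMap ℂ (fun _ : Fin (n - 1) => A) A)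
    (mul : Mspace p A →ₗ[ℂ] Mspace p A →ₗ[ℂ] Mspace p A) : Prop :=
  ∀ (k l : Fin p) (a b : ℕ → A),
    mul (incl p A k (tp A (k.1 + 1) a)) (incl p A l (tp A (l.1 + 1) b)) =
      if h : (k.1 + 1) + (l.1 + 1) ≤ p then
        incl p A ⟨k.1 + l.1 + 1, by omega⟩
          (tp A (k.1 + l.1 + 1 + 1)
            (fun i => if i < k.1 + 1 then a i else b (i - (k.1 + 1))))
      else
        incl p A ⟨k.1 + l.1 + 1 - p, by have := k.isLt; have := l.isLt; omega⟩
          (tp A (k.1 + l.1 + 1 - p + 1)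
            (fun i =>
              if i = 0 then
                Γ (fun j : Fin (n - 1) =>
                  if j.1 < k.1 + 1 then a j.1 else b (j.1 - (k.1 + 1)))
              else b (p - (k.1 + 1) + i)))

/-- The subspace `I_k ⊆ A₁^{⊗k}`: `I₁ = {0}`, and for `2 ≤ k ≤ p`,
`I_k = {a : a·b = 0 for all b ∈ A₁^{⊗(p+1−k)}}`.  (The component of index `k : Fin p`
has degree `k + 1`.) -/
def Ik (p : ℕ) (A : Type) [AddCommGroup A] [Module ℂ A]
    (mul : Mspace p A →ₗ[ℂ] Mspace p A →ₗ[ℂ] Mspace p A) (k : Fin p) :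
    Submodule ℂ (⨂[ℂ]^(k.1 + 1) A) :=
  if k.1 = 0 then ⊥
  else
    ⨅ y : ⨂[ℂ]^(p - (k.1 + 1) + 1) A,
      LinearMap.ker
        ((mul.flip (incl p A ⟨p - (k.1 + 1), by have := k.isLt; omega⟩ y)).comp (incl p A k))

/-- The subspace `I = ⊕_{k=1}^{p} I_k ⊆ M`. -/
def Isub (p : ℕ) (A : Type) [AddCommGroup A] [Module ℂ A]
    (mul : Mspace p A →ₗ[ℂ] Mspace p A →ₗ[ℂ] Mspace p A) : Submodule ℂ (Mspace p A) :=
  ⨆ k : Fin p, (Ik p A mul k).map (incl p A k)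

/-- `qM` is the bilinear form on `M` determined on homogeneous pure tensors
`a ∈ A₁^{⊗k}`, `b ∈ A₁^{⊗l}` by: `q(a,b) = 0` if `k + l ≢ 2 mod p`;
`q(a,b) = q₁(a₁, Γ(a₂,…,a_k,b₁,…,b_l))` if `k + l = n`; and `q(a,b) = q₁(a₁,b₁)` if
`k = l = 1`. -/
def QSpec (n p : ℕ) (A : Type) [AddCommGroup A] [Module ℂ A]
    (Γ : MultilinearMap ℂ (fun _ : Fin (n - 1) => A) A)
    (q₁ : A →ₗ[ℂ] A →ₗ[ℂ] ℂ)
    (qM : Mspace p A →ₗ[ℂ] Mspace p A →ₗ[ℂ] ℂ) : Prop :=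
  ∀ (k l : Fin p) (a b : ℕ → A),
    qM (incl p A k (tp A (k.1 + 1) a)) (incl p A l (tp A (l.1 + 1) b)) =
      if ((k.1 + 1) + (l.1 + 1)) % p = 2 % p then
        (if (k.1 + 1) + (l.1 + 1) = n then
          q₁ (a 0) (Γ (fun j : Fin (n - 1) =>
            if j.1 + 1 < k.1 + 1 then a (j.1 + 1) else b (j.1 + 1 - (k.1 + 1))))
        else q₁ (a 0) (b 0))
      else 0

section Helpers

variable {A : Type} [AddCommGroup A] [Module ℂ A]

/-- `Γ` evaluated on a list. -/
def gEval {n : ℕ} (Γ : MultilinearMap ℂ (fun _ : Fin (n - 1) => A) A) (w : List A) : A :=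
  Γ (fun j : Fin (n - 1) => w.getD j.1 0)

/-- One-step reduction of a word. -/
def wred (p : ℕ) (G : List A → A) (l : List A) : List A :=
  if l.length ≤ p then l else G (l.take (p + 1)) :: l.drop (p + 1)

/-- Full left-nested evaluation of a word. -/
def fullEval (p : ℕ) (G : List A → A) (l : List A) : A :=
  if h : l.length ≤ p ∨ p = 0 then l.headD 0
  else fullEval p G (G (l.take (p + 1)) :: l.drop (p + 1))
termination_by l.length
decreasing_by
  simp only [List.length_cons, List.length_drop]
  omega

theorem gEval_ins {n p : ℕ} (hn : 3 ≤ n) (hp : p = n - 2)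
    (Γ : MultilinearMap ℂ (fun _ : Fin (n - 1) => A) A)
    (u w v : List A) (hw : w.length = p + 1) (h : u.length + v.length = p) :
    gEval Γ (u ++ gEval Γ w :: v) =
      gammaIns n A Γ u.length (fun i => (u ++ (w ++ v)).getD i 0) := by
  unfold gammaIns
  conv_lhs => unfold gEval
  congr 1
  funext i
  have hi := i.2
  by_cases h1 : i.1 < u.length
  · simp only [h1, if_true]
    rw [List.getD_append _ _ _ _ h1, List.getD_append _ _ _ _ h1]
  · by_cases h2 : i.1 = u.length
    · simp only [h2, lt_irrefl, if_false, if_true]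
      rw [List.getD_append_right _ _ _ _ (by omega)]
      simp only [Nat.sub_self, List.getD_cons_zero]
      congr 1
      funext j
      have hj := j.2
      rw [List.getD_append_right _ _ _ _ (by omega), List.getD_append _ _ _ _ (by omega)]
      congr 1
      omega
    · simp only [h1, h2, if_false]
      rw [List.getD_append_right _ _ _ _ (by omega), List.getD_append_right _ _ _ _ (by omega),
        List.getD_append_right _ _ _ _ (by omega)]
      obtain ⟨t, ht⟩ : ∃ t, i.1 = u.length + 1 + t := ⟨i.1 - (u.length + 1), by omega⟩
      have e1 : i.1 - u.length = t + 1 := by omega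
      have e2 : i.1 + (n - 2) - u.length - w.length = t := by omega
      rw [e1, e2, List.getD_cons_succ]

/-- The list form of general associativity. -/
def GAssoc (p : ℕ) (G : List A → A) : Prop :=
  ∀ u w v : List A, w.length = p + 1 → u.length + v.length = p →
    G (u ++ G w :: v) = G (G ((u ++ (w ++ v)).take (p + 1)) :: (u ++ (w ++ v)).drop (p + 1))

theorem gEval_assoc {n p : ℕ} (hn : 3 ≤ n) (hp : p = n - 2)
    (Γ : MultilinearMap ℂ (fun _ : Fin (n - 1) => A) A)
    (hassoc : ∀ r s : ℕ, r ≤ n - 2 → s ≤ n - 2 → ∀ a : ℕ → A,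
      gammaIns n A Γ r a = gammaIns n A Γ s a) : GAssoc p (gEval Γ) := by
  intro u w v hw h
  rw [gEval_ins hn hp Γ u w v hw h, hassoc u.length 0 (by omega) (by omega)]
  have := gEval_ins hn hp Γ [] ((u ++ (w ++ v)).take (p + 1)) ((u ++ (w ++ v)).drop (p + 1))
    (by simp; omega) (by simp; omega)
  simp only [List.nil_append, List.take_append_drop, List.length_nil] at this
  exact this.symm

theorem fullEval_step {p : ℕ} (hp : 0 < p) (G : List A → A) (l : List A) (h : p < l.length) :
    fullEval p G l = fullEval p G (G (l.take (p + 1)) :: l.drop (p + 1)) := by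
  rw [fullEval, dif_neg (by omega)]

theorem fullEval_sub {p : ℕ} (hp : 0 < p) (G : List A → A) (hG : GAssoc p G) :
    ∀ (j : ℕ) (u w v : List A), w.length = p + 1 →
      u.length + w.length + v.length = j * p + 1 →
      fullEval p G (u ++ (w ++ v)) = fullEval p G (u ++ G w :: v) := by
  intro j
  induction j with
  | zero => intro u w v hw h; omega
  | succ j ih =>
    intro u w v hw h
    rw [Nat.succ_mul] at h
    by_cases h0 : u = []
    · subst h0
      rw [fullEval_step hp]
      · simp only [List.nil_append]
        rw [← hw, List.take_left, List.drop_left]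
      · simp; omega
    · have hu : 0 < u.length := List.length_pos_iff.mpr h0
      by_cases h1 : p + 1 ≤ u.length
      · rw [fullEval_step hp _ _ (by simp; omega),
          fullEval_step hp _ (u ++ G w :: v) (by simp; omega)]
        rw [List.take_append_of_le_length h1, List.drop_append_of_le_length h1,
          List.take_append_of_le_length h1, List.drop_append_of_le_length h1]
        exact ih (G (u.take (p + 1)) :: u.drop (p + 1)) w v hw (by simp; omega)
      · have hj : 1 ≤ j := by
          rcases Nat.eq_zero_or_pos j with h | h
          · subst h; omega
          · exact h
        have hjp : 1 * p ≤ j * p := Nat.mul_le_mul_right p hj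
        have hv : p - u.length ≤ v.length := by omega
        obtain ⟨v1, v2, rfl, hv1⟩ : ∃ v1 v2, v = v1 ++ v2 ∧ v1.length = p - u.length :=
          ⟨v.take (p - u.length), v.drop (p - u.length), by simp, by simp; omega⟩
        have key := hG u w v1 hw (by omega)
        have e1 : u ++ G w :: (v1 ++ v2) = (u ++ G w :: v1) ++ v2 := by simp
        have e2 : u ++ (w ++ (v1 ++ v2)) = (u ++ (w ++ v1)) ++ v2 := by simp
        have l1 : (u ++ G w :: v1).length = p + 1 := by simp; omega
        rw [e1, e2]
        have l2 : (u ++ (w ++ v1)).length = 2 * p + 1 := by simp; omega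
        generalize u ++ (w ++ v1) = x at *
        generalize u ++ G w :: v1 = y at *
        rw [fullEval_step hp _ (y ++ v2) (by simp; omega),
          List.take_append_of_le_length (by omega), List.drop_append_of_le_length (by omega),
          List.take_of_length_le (by omega), List.drop_of_length_le (by omega), key,
          fullEval_step hp _ (x ++ v2) (by simp; omega),
          List.take_append_of_le_length (by omega), List.drop_append_of_le_length (by omega)]
        have e3 : G (List.take (p + 1) x) :: (List.drop (p + 1) x ++ v2) =
          (G (List.take (p + 1) x) :: List.drop (p + 1) x) ++ v2 := by simp
        have l3 : (G (List.take (p + 1) x) :: List.drop (p + 1) x).length = p + 1 := by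
          simp; omega
        rw [e3]
        generalize G (List.take (p + 1) x) :: List.drop (p + 1) x = z at *
        rw [fullEval_step hp _ (z ++ v2) (by simp; omega),
          List.take_append_of_le_length (by omega), List.drop_append_of_le_length (by omega),
          List.take_of_length_le (by omega), List.drop_of_length_le (by omega)]

theorem fullEval_wred {p : ℕ} (hp : 0 < p) (G : List A → A) (hG : GAssoc p G)
    (j : ℕ) (u x v : List A) (h : u.length + x.length + v.length = j * p + 1) :
    fullEval p G (u ++ (wred p G x ++ v)) = fullEval p G (u ++ (x ++ v)) := by
  unfold wred
  split_ifs with hx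
  · rfl
  · have := fullEval_sub hp G hG j u (x.take (p + 1)) (x.drop (p + 1) ++ v)
      (by simp; omega) (by simp; omega)
    rw [← List.append_assoc (x.take (p + 1)), List.take_append_drop] at this
    rw [this]
    simp

theorem wred_length {p : ℕ} (G : List A → A) (l : List A) :
    (wred p G l).length = if l.length ≤ p then l.length else l.length - p := by
  unfold wred
  split_ifs with h
  · rfl
  · simp; omega

theorem eq_of_length_one {p : ℕ} (hp : 0 < p) (G : List A → A) (x y : List A)
    (hx : x.length = 1) (hy : y.length = 1) (h : fullEval p G x = fullEval p G y) : x = y := by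
  obtain ⟨a, rfl⟩ := List.length_eq_one_iff.mp hx
  obtain ⟨b, rfl⟩ := List.length_eq_one_iff.mp hy
  rw [fullEval, dif_pos (by simp; omega), fullEval, dif_pos (by simp; omega)] at h
  simpa using h

/-- The element of `M` attached to a word. -/
def wordM (p : ℕ) (l : List A) : Mspace p A :=
  if h : l.length - 1 < p then incl p A ⟨l.length - 1, h⟩ (tp A (l.length - 1 + 1)
    (fun i => l.getD i 0)) else 0

theorem incl_tp_congr {p : ℕ} (k k' : ℕ) (hk : k < p) (hk' : k' < p) (a b : ℕ → A)
    (e : k = k') (h : ∀ i < k + 1, a i = b i) :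
    incl p A ⟨k, hk⟩ (tp A (k + 1) a) = incl p A ⟨k', hk'⟩ (tp A (k' + 1) b) := by
  subst e
  congr 1
  unfold tp
  congr 1
  funext i
  exact h i.1 i.2

theorem mul_wordM {n p : ℕ} (hn : 3 ≤ n) (hp : p = n - 2)
    (Γ : MultilinearMap ℂ (fun _ : Fin (n - 1) => A) A)
    (mul : Mspace p A →ₗ[ℂ] Mspace p A →ₗ[ℂ] Mspace p A)
    (hmul : MulSpec n p A Γ mul) (u v : List A)
    (hu : 0 < u.length) (hu' : u.length ≤ p) (hv : 0 < v.length) (hv' : v.length ≤ p) :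
    mul (wordM p u) (wordM p v) = wordM p (wred p (gEval Γ) (u ++ v)) := by
  have hl := wred_length (p := p) (gEval Γ) (u ++ v)
  rw [List.length_append] at hl
  have hb : (wred p (gEval Γ) (u ++ v)).length - 1 < p := by
    rw [hl]; split_ifs <;> omega
  rw [wordM, wordM, wordM, dif_pos (by omega), dif_pos (by omega), dif_pos hb, hmul]
  split_ifs with h
  · simp only at h
    rw [if_pos (by omega)] at hl
    apply incl_tp_congr
    · simp only; omega
    · intro i hi
      simp only at hi ⊢
      rw [show wred p (gEval Γ) (u ++ v) = u ++ v from if_pos (by simp; omega)]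
      split_ifs with h1
      · rw [List.getD_append _ _ _ _ (by omega)]
      · rw [List.getD_append_right _ _ _ _ (by omega)]
        congr 1; omega
  · simp only at h
    rw [if_neg (by omega)] at hl
    apply incl_tp_congr
    · simp only; omega
    · intro i hi
      simp only at hi ⊢
      rw [show wred p (gEval Γ) (u ++ v) = gEval Γ ((u ++ v).take (p + 1)) ::
        (u ++ v).drop (p + 1) from if_neg (by simp; omega)]
      split_ifs with h1
      · subst h1
        rw [List.getD_cons_zero, gEval]
        congr 1
        funext j
        have hj := j.2
        have e : (List.take (p + 1) (u ++ v)).getD j.1 0 = (u ++ v).getD j.1 0 := by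
          simp only [List.getD_eq_getElem?_getD]
          rw [List.getElem?_take_of_lt (by omega)]
        rw [e]
        split_ifs with h2
        · rw [List.getD_append _ _ _ _ (by omega)]
        · rw [List.getD_append_right _ _ _ _ (by omega)]
          congr 1; omega
      · obtain ⟨t, rfl⟩ : ∃ t, i = t + 1 := ⟨i - 1, by omega⟩
        rw [List.getD_cons_succ]
        have e : (List.drop (p + 1) (u ++ v)).getD t 0 = (u ++ v).getD (p + 1 + t) 0 := by
          simp only [List.getD_eq_getElem?_getD, List.getElem?_drop]
        rw [e, List.getD_append_right _ _ _ _ (by omega)]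
        congr 1; omega

theorem incl_tprod {p : ℕ} (k : Fin p) (f : Fin (k.1 + 1) → A) :
    incl p A k (PiTensorProduct.tprod ℂ f) = wordM p (List.ofFn f) := by
  have h : (List.ofFn f).length - 1 < p := by simp
  rw [wordM, dif_pos h]
  have e : (PiTensorProduct.tprod ℂ f : ⨂[ℂ]^(k.1 + 1) A) =
      tp A (k.1 + 1) (fun i => (List.ofFn f).getD i 0) := by
    unfold tp
    congr 1
    funext i
    beta_reduce
    rw [List.getD_eq_getElem _ _ (by rw [List.length_ofFn]; exact i.2), List.getElem_ofFn]
  rw [e]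
  exact incl_tp_congr k.1 _ k.2 _ _ _ (by simp) (fun _ _ => rfl)

/-- Two linear maps agreeing on all words of the length `k + 1` agree on the component. -/
theorem word_ind {p : ℕ} (k : Fin p) (f g : Mspace p A →ₗ[ℂ] Mspace p A)
    (h : ∀ l : List A, l.length = k.1 + 1 → f (wordM p l) = g (wordM p l))
    (x : ⨂[ℂ]^(k.1 + 1) A) : f (incl p A k x) = g (incl p A k x) := by
  induction x using PiTensorProduct.induction_on with
  | smul_tprod r a =>
    rw [map_smul, map_smul, map_smul, incl_tprod, h _ (by simp)]
  | add x y hx hy => rw [map_add, map_add, map_add, hx, hy]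

theorem one_of_mod {p t j : ℕ} (h0 : 0 < t) (h1 : t ≤ p) (h : t = j * p + 1) : t = 1 := by
  rcases Nat.eq_zero_or_pos j with hj | hj
  · subst hj; omega
  · have : 1 * p ≤ j * p := Nat.mul_le_mul_right p hj
    omega

theorem exists_of_mod {p t : ℕ} (h0 : 0 < t) (h : t % p = 1 % p) : ∃ j, t = j * p + 1 := by
  have h2 : p ∣ t - 1 := (Nat.modEq_iff_dvd' h0).mp h.symm
  obtain ⟨c, hc⟩ := h2
  exact ⟨c, by rw [mul_comm]; omega⟩

theorem wred_length_bounds {p : ℕ} (G : List A → A) (l : List A) (h0 : 0 < l.length)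
    (h1 : l.length ≤ 2 * p) : 0 < (wred p G l).length ∧ (wred p G l).length ≤ p ∧
      ((wred p G l).length = l.length ∨ (wred p G l).length + p = l.length) := by
  rw [wred_length]
  split_ifs <;> omega

/-- If `x` and `y` have lengths in `[1, 2p]` congruent to `1`, and the same full evaluation,
then their reductions coincide. -/
theorem wred_eq {p : ℕ} (hp : 0 < p) (G : List A → A) (hG : GAssoc p G) (x y : List A)
    (hx0 : 0 < x.length) (hx : x.length ≤ 2 * p) (hy0 : 0 < y.length) (hy : y.length ≤ 2 * p)
    (hxm : x.length % p = 1 % p) (hym : y.length % p = 1 % p)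
    (h : fullEval p G x = fullEval p G y) : wred p G x = wred p G y := by
  have aux : ∀ z : List A, 0 < z.length → z.length ≤ 2 * p → z.length % p = 1 % p →
      (wred p G z).length = 1 ∧ fullEval p G (wred p G z) = fullEval p G z := by
    intro z h0 h1 hm
    obtain ⟨b0, b1, b2⟩ := wred_length_bounds G z h0 h1
    obtain ⟨j, hj⟩ := exists_of_mod h0 hm
    have hm' : (wred p G z).length % p = 1 % p := by
      rcases b2 with b2 | b2
      · rw [b2, hm]
      · rw [← hm, ← b2, Nat.add_mod_right]
    obtain ⟨i, hi⟩ := exists_of_mod b0 hm'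
    refine ⟨one_of_mod b0 b1 hi, ?_⟩
    have := fullEval_wred hp G hG j [] z [] (by simpa using hj)
    simpa using this
  obtain ⟨x1, x2⟩ := aux x hx0 hx hxm
  obtain ⟨y1, y2⟩ := aux y hy0 hy hym
  exact eq_of_length_one hp G _ _ x1 y1 (by rw [x2, y2, h])

theorem mod_of_or {p s t : ℕ} (h : s = t ∨ s + p = t) : s % p = t % p := by
  rcases h with h | h
  · rw [h]
  · rw [← h, Nat.add_mod_right]

theorem words_three {p : ℕ} (hp : 0 < p) (G : List A → A) (hG : GAssoc p G) (a b c : List A)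
    (ha : 0 < a.length) (ha' : a.length ≤ p) (hb : 0 < b.length) (hb' : b.length ≤ p)
    (hc : 0 < c.length) (hc' : c.length ≤ p)
    (h : (a.length + b.length + c.length) % p = 1 % p) :
    wred p G (wred p G (a ++ b) ++ c) = wred p G (a ++ wred p G (b ++ c)) := by
  obtain ⟨p0, p1, p2⟩ := wred_length_bounds (p := p) G (a ++ b) (by simp; omega) (by simp; omega)
  obtain ⟨q0, q1, q2⟩ := wred_length_bounds (p := p) G (b ++ c) (by simp; omega) (by simp; omega)
  obtain ⟨j, hj⟩ := exists_of_mod (by omega) h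
  have e1 := fullEval_wred hp G hG j [] (a ++ b) c (by simp; omega)
  have e2 := fullEval_wred hp G hG j a (b ++ c) [] (by simp; omega)
  simp only [List.nil_append, List.append_nil, List.append_assoc] at e1 e2
  rw [List.length_append] at p2 q2
  refine wred_eq hp G hG _ _ ?_ ?_ ?_ ?_ ?_ ?_ (e1.trans e2.symm)
  · simp; omega
  · simp; omega
  · simp; omega
  · simp; omega
  · rw [← h, List.length_append]; exact mod_of_or (by omega)
  · rw [← h, List.length_append]; exact mod_of_or (by omega)

theorem words_four {p : ℕ} (hp : 0 < p) (G : List A → A) (hG : GAssoc p G) (a b c d : List A)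
    (ha : 0 < a.length) (ha' : a.length ≤ p) (hb : 0 < b.length) (hb' : b.length ≤ p)
    (hc : 0 < c.length) (hc' : c.length ≤ p) (hd : 0 < d.length) (hd' : d.length ≤ p)
    (h : (a.length + b.length + c.length + d.length) % p = 1 % p) :
    wred p G (wred p G (wred p G (a ++ b) ++ c) ++ d) =
      wred p G (wred p G (a ++ wred p G (b ++ c)) ++ d) := by
  obtain ⟨p0, p1, p2⟩ := wred_length_bounds (p := p) G (a ++ b) (by simp; omega) (by simp; omega)
  obtain ⟨q0, q1, q2⟩ := wred_length_bounds (p := p) G (b ++ c) (by simp; omega) (by simp; omega)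
  obtain ⟨r0, r1, r2⟩ := wred_length_bounds (p := p) G (wred p G (a ++ b) ++ c)
    (by simp; omega) (by simp; omega)
  obtain ⟨s0, s1, s2⟩ := wred_length_bounds (p := p) G (a ++ wred p G (b ++ c))
    (by simp; omega) (by simp; omega)
  rw [List.length_append] at p2 q2 r2 s2
  have m1 : ((wred p G (a ++ b)).length + c.length + d.length) % p = 1 % p := by
    rw [← h]; exact mod_of_or (by omega)
  have m2 : (a.length + (wred p G (b ++ c)).length + d.length) % p = 1 % p := by
    rw [← h]; exact mod_of_or (by omega)
  obtain ⟨j, hj⟩ := exists_of_mod (by omega) h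
  obtain ⟨j1, hj1⟩ := exists_of_mod (by omega) m1
  obtain ⟨j2, hj2⟩ := exists_of_mod (by omega) m2
  have e1 := fullEval_wred hp G hG j [] (a ++ b) (c ++ d) (by simp; omega)
  have e2 := fullEval_wred hp G hG j a (b ++ c) d (by simp; omega)
  have e3 := fullEval_wred hp G hG j1 [] (wred p G (a ++ b) ++ c) d (by simp; omega)
  have e4 := fullEval_wred hp G hG j2 [] (a ++ wred p G (b ++ c)) d (by simp; omega)
  simp only [List.nil_append, List.append_assoc] at e1 e2 e3 e4
  refine wred_eq hp G hG _ _ ?_ ?_ ?_ ?_ ?_ ?_ (e3.trans (e1.trans (e2.symm.trans e4.symm)))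
  · simp; omega
  · simp; omega
  · simp; omega
  · simp; omega
  · rw [← m1, List.length_append]; exact mod_of_or (by omega)
  · rw [← m2, List.length_append]; exact mod_of_or (by omega)

end Helpers

/-- For homogeneous elements `a ∈ A₁^{⊗n_a}`, `b ∈ A₁^{⊗n_b}`,
`c ∈ A₁^{⊗n_c}` of `M` with `n_a + n_b + n_c ≡ 1 mod p`, one has `(a·b)·c = a·(b·c)`;
and for homogeneous `a, b, c, d` with `n_a + n_b + n_c + n_d ≡ 1 mod p`, one has
`((a·b)·c)·d = (a·(b·c))·d`. -/
theorem mul_assoc_of_total_degree_one_mod_p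
    (n p : ℕ) (hn : 3 ≤ n) (hp : p = n - 2)
    (A : Type) [AddCommGroup A] [Module ℂ A] [FiniteDimensional ℂ A]
    (Γ : MultilinearMap ℂ (fun _ : Fin (n - 1) => A) A)
    (q₁ : A →ₗ[ℂ] A →ₗ[ℂ] ℂ)
    (hq₁symm : ∀ x y : A, q₁ x y = q₁ y x)
    (hq₁nondeg : ∀ x : A, (∀ y : A, q₁ x y = 0) → x = 0)
    (hinv : ∀ a : ℕ → A,
      q₁ (Γ (fun i : Fin (n - 1) => a i.1)) (a (n - 1)) =
        q₁ (a 0) (Γ (fun i : Fin (n - 1) => a (i.1 + 1))))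
    (hassoc : ∀ r s : ℕ, r ≤ n - 2 → s ≤ n - 2 → ∀ a : ℕ → A,
      gammaIns n A Γ r a = gammaIns n A Γ s a)
    (mul : Mspace p A →ₗ[ℂ] Mspace p A →ₗ[ℂ] Mspace p A)
    (hmul : MulSpec n p A Γ mul)
    :
    (∀ k l m : Fin p, ((k.1 + 1) + (l.1 + 1) + (m.1 + 1)) % p = 1 % p →
      ∀ (x : ⨂[ℂ]^(k.1 + 1) A) (y : ⨂[ℂ]^(l.1 + 1) A) (z : ⨂[ℂ]^(m.1 + 1) A),
        mul (mul (incl p A k x) (incl p A l y)) (incl p A m z) =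
          mul (incl p A k x) (mul (incl p A l y) (incl p A m z))) ∧
    (∀ k l m j : Fin p,
      ((k.1 + 1) + (l.1 + 1) + (m.1 + 1) + (j.1 + 1)) % p = 1 % p →
      ∀ (x : ⨂[ℂ]^(k.1 + 1) A) (y : ⨂[ℂ]^(l.1 + 1) A) (z : ⨂[ℂ]^(m.1 + 1) A)
        (w : ⨂[ℂ]^(j.1 + 1) A),
        mul (mul (mul (incl p A k x) (incl p A l y)) (incl p A m z)) (incl p A j w) =
          mul (mul (incl p A k x) (mul (incl p A l y) (incl p A m z))) (incl p A j w)) := by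
  have hp0 : 0 < p := by omega
  have hG := gEval_assoc hn hp Γ hassoc
  have hm := mul_wordM hn hp Γ mul hmul
  have hB := fun l : List A => wred_length_bounds (p := p) (gEval Γ) l
  constructor
  · intro k l m h x y z
    have hk := k.2
    have hl := l.2
    have hm' := m.2
    refine word_ind k ((mul.flip (incl p A m z)).comp (mul.flip (incl p A l y)))
      (mul.flip (mul (incl p A l y) (incl p A m z))) ?_ x
    intro a ha
    refine word_ind l ((mul.flip (incl p A m z)).comp (mul (wordM p a)))
      ((mul (wordM p a)).comp (mul.flip (incl p A m z))) ?_ y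
    intro b hb
    refine word_ind m (mul (mul (wordM p a) (wordM p b)))
      ((mul (wordM p a)).comp (mul (wordM p b))) ?_ z
    intro c hc
    obtain ⟨p0, p1, -⟩ := hB (a ++ b) (by simp; omega) (by simp; omega)
    obtain ⟨q0, q1, -⟩ := hB (b ++ c) (by simp; omega) (by simp; omega)
    rw [LinearMap.comp_apply, hm a b (by omega) (by omega) (by omega) (by omega),
      hm b c (by omega) (by omega) (by omega) (by omega),
      hm _ c p0 p1 (by omega) (by omega), hm a _ (by omega) (by omega) q0 q1,
      words_three hp0 _ hG a b c (by omega) (by omega) (by omega) (by omega) (by omega)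
        (by omega) (by rw [ha, hb, hc, h])]
  · intro k l m j h x y z w
    have hk := k.2
    have hl := l.2
    have hm' := m.2
    have hj := j.2
    refine word_ind k
      ((mul.flip (incl p A j w)).comp ((mul.flip (incl p A m z)).comp (mul.flip (incl p A l y))))
      ((mul.flip (incl p A j w)).comp (mul.flip (mul (incl p A l y) (incl p A m z)))) ?_ x
    intro a ha
    refine word_ind l
      ((mul.flip (incl p A j w)).comp ((mul.flip (incl p A m z)).comp (mul (wordM p a))))
      ((mul.flip (incl p A j w)).comp ((mul (wordM p a)).comp (mul.flip (incl p A m z)))) ?_ y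
    intro b hb
    refine word_ind m ((mul.flip (incl p A j w)).comp (mul (mul (wordM p a) (wordM p b))))
      ((mul.flip (incl p A j w)).comp ((mul (wordM p a)).comp (mul (wordM p b)))) ?_ z
    intro c hc
    refine word_ind j (mul (mul (mul (wordM p a) (wordM p b)) (wordM p c)))
      (mul (mul (wordM p a) (mul (wordM p b) (wordM p c)))) ?_ w
    intro d hd
    obtain ⟨p0, p1, -⟩ := hB (a ++ b) (by simp; omega) (by simp; omega)
    obtain ⟨q0, q1, -⟩ := hB (b ++ c) (by simp; omega) (by simp; omega)
    obtain ⟨r0, r1, -⟩ := hB (wred p (gEval Γ) (a ++ b) ++ c) (by simp; omega) (by simp; omega)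
    obtain ⟨s0, s1, -⟩ := hB (a ++ wred p (gEval Γ) (b ++ c)) (by simp; omega) (by simp; omega)
    rw [hm a b (by omega) (by omega) (by omega) (by omega),
      hm b c (by omega) (by omega) (by omega) (by omega),
      hm _ c p0 p1 (by omega) (by omega), hm a _ (by omega) (by omega) q0 q1,
      hm _ d r0 r1 (by omega) (by omega), hm _ d s0 s1 (by omega) (by omega),
      words_four hp0 _ hG a b c d (by omega) (by omega) (by omega) (by omega) (by omega)
        (by omega) (by omega) (by omega) (by rw [ha, hb, hc, hd, h])]
end
end
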